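/- Let a, b, c ∈ ℚ and let g ∈ ℚ[[X]] be the unique power series with constant coefficient 1 satisfying X²(b + cX)·g² + (1 − aX − bX²)·g = 1. Set A := (g(−X))⁻¹, where g(−X) is the rescaling of g by −1, and let B := (a − cX)·(1 + bX)⁻¹. Then A = 1 + X·B(X²·A⁻¹), where B(X²·A⁻¹) denotes the substitution of the series X²·A⁻¹ (which has constant coefficient 0) into B. (This expresses that the Bell pseudo-involution (g(x), xg(x)) has B-sequence with generating function B(x) = (a − cx)/(1 + bx), via the relation A(x) = 1 + x·B(x²/A(x)) between the A-sequence and the B-sequence.) -/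

import Mathlib

open PowerSeries

/-- Substitution of the power series `f` (intended: with zero constant coefficient) into the
power series `g`: the `n`-th coefficient of `g(f)` is `∑_{k=0}^{n} gₖ · [Xⁿ] fᵏ`. -/
noncomputable def substSeries (f g : PowerSeries ℚ) : PowerSeries ℚ :=
  PowerSeries.mk fun n => ∑ k ∈ Finset.range (n + 1), coeff k g * coeff n (f ^ k)

lemma substSeries_eq (f g : PowerSeries ℚ) (hf : constantCoeff f = 0) :
    substSeries f g = g.subst f := by
  ext n
  rw [coeff_subst' (HasSubst.of_constantCoeff_zero' hf), substSeries, coeff_mk]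
  symm
  apply finsum_eq_finsetSum_of_support_subset
  intro k hk
  by_contra h
  apply hk
  have hlt : n < k := by
    simpa using h
  have : coeff n (f ^ k) = 0 := by
    obtain ⟨q, hq⟩ := X_dvd_iff.mpr hf
    rw [hq, mul_pow]
    exact X_pow_dvd_iff.mp (Dvd.intro _ rfl) n hlt
  simp [this]

theorem stmt_17 (a b c : ℚ) (g : PowerSeries ℚ)
    (hg0 : constantCoeff g = 1)
    (hg : X ^ 2 * (C b + C c * X) * g ^ 2 + (1 - C a * X - C b * X ^ 2) * g = 1) :
    (rescale (-1) g)⁻¹ =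
      1 + X * substSeries (X ^ 2 * ((rescale (-1) g)⁻¹)⁻¹)
        ((C a - C c * X) * (1 + C b * X)⁻¹) := by
  have hC : ∀ r : ℚ, rescale (-1 : ℚ) (C r) = C r := by
    intro r
    ext n
    rw [coeff_rescale, coeff_C]
    split_ifs with h <;> simp [h]
  have hX : rescale (-1 : ℚ) X = -X := by
    ext n
    rw [coeff_rescale, map_neg, coeff_X]
    split_ifs with h <;> simp [h]
  have hh := congrArg (rescale (-1 : ℚ)) hg
  simp only [map_add, map_mul, map_sub, map_pow, map_one, hC, hX] at hh
  have hh0 : constantCoeff (rescale (-1 : ℚ) g) = 1 := by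
    rw [← coeff_zero_eq_constantCoeff_apply, coeff_rescale]
    simpa using hg0
  generalize rescale (-1 : ℚ) g = h at hh hh0
  have hinv : h⁻¹⁻¹ = h := by
    rw [PowerSeries.inv_eq_iff_mul_eq_one (by simp [hh0])]
    exact PowerSeries.mul_inv_cancel h (by simp [hh0])
  have hf : constantCoeff (X ^ 2 * h) = 0 := by simp
  have hs := HasSubst.of_constantCoeff_zero' hf
  rw [hinv, substSeries_eq _ _ hf]
  set S : PowerSeries ℚ := ((C a - C c * X) * (1 + C b * X)⁻¹ : PowerSeries ℚ).subst (X ^ 2 * h) with hS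
  have hone : (1 + C b * X : PowerSeries ℚ)⁻¹ * (1 + C b * X) = 1 :=
    PowerSeries.inv_mul_cancel _ (by simp)
  have sC : ∀ r : ℚ, substAlgHom (R := ℚ) hs (C r) = C r := by
    intro r
    rw [coe_substAlgHom, subst_C]; rfl
  have sX : substAlgHom (R := ℚ) hs X = X ^ 2 * h := substAlgHom_X hs
  have key : S * (1 + C b * (X ^ 2 * h)) = C a - C c * (X ^ 2 * h) := by
    have : ((C a - C c * X) * (1 + C b * X)⁻¹ : PowerSeries ℚ) * (1 + C b * X) = C a - C c * X := by
      rw [mul_assoc, hone, mul_one]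
    generalize ((C a - C c * X) * (1 + C b * X)⁻¹ : PowerSeries ℚ) = Q at this hS
    have h2 := congrArg (substAlgHom (R := ℚ) hs) this
    rw [map_mul, map_add, map_sub, map_mul, map_mul, map_one, sC, sC, sC, sX] at h2
    rw [hS, ← coe_substAlgHom hs]
    exact h2
  have hne : (1 + C b * (X ^ 2 * h)) ≠ 0 := by
    intro h0
    have := congrArg constantCoeff h0
    simp at this
  rw [PowerSeries.inv_eq_iff_mul_eq_one (by simp [hh0])]
  apply mul_right_cancel₀ hne
  linear_combination h * X * key + hh
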